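/- Let s < k ≤ n be positive integers. Multiplication by e_{n−s}(x_1, …, x_n) maps the ideal I_{n,k−1,s} into I_{n,k,s}, hence induces a ℚ-linear map φ : R_{n,k−1,s} → R_{n,k,s}; moreover I_{n,k,s} ⊆ I_{n,k,s+1}, so the identity induces a canonical projection π : R_{n,k,s} → R_{n,k,s+1}. Then φ is injective, π is surjective, and the image of φ equals the kernel of π; that is, 0 → R_{n,k−1,s} → R_{n,k,s} → R_{n,k,s+1} → 0 is a short exact sequence (of S_n-modules, with φ homogeneous of degree n−s and π of degree 0). -/

import Mathlib

open MvPolynomial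

/-- The ideal `I_{n,k,s} ⊆ ℚ[x_1, …, x_n]` generated by `x_1^k, …, x_n^k` together with
the elementary symmetric polynomials `e_d(x_1, …, x_n)` for `n−s+1 ≤ d ≤ n`. -/
noncomputable def Inks (n k s : ℕ) : Ideal (MvPolynomial (Fin n) ℚ) :=
  Ideal.span ({p | ∃ i : Fin n, p = X i ^ k} ∪
    {p | ∃ d : ℕ, n - s + 1 ≤ d ∧ d ≤ n ∧ p = esymm (Fin n) ℚ d})

/-- The ideal `Inks n k s`, with the condition on the degrees of the elementary symmetric
polynomials written without truncated subtraction. -/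
noncomputable def powEsymmIdeal (n k s : ℕ) : Ideal (MvPolynomial (Fin n) ℚ) :=
  Ideal.span ({p | ∃ i : Fin n, p = X i ^ k} ∪
    {p | ∃ d : ℕ, n + 1 ≤ d + s ∧ p = esymm (Fin n) ℚ d})

lemma esymm_eq_zero_of_lt {n d : ℕ} (h : n < d) : esymm (Fin n) ℚ d = 0 := by
  rw [esymm, Finset.powersetCard_eq_empty.2 (by simpa using h), Finset.sum_empty]

lemma X_pow_mem_powEsymmIdeal {n k s : ℕ} (i : Fin n) : X i ^ k ∈ powEsymmIdeal n k s :=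
  Ideal.subset_span (Or.inl ⟨i, rfl⟩)

lemma esymm_mem_powEsymmIdeal {n k s d : ℕ} (h : n + 1 ≤ d + s) :
    esymm (Fin n) ℚ d ∈ powEsymmIdeal n k s :=
  Ideal.subset_span (Or.inr ⟨d, h, rfl⟩)

lemma Inks_eq_powEsymmIdeal {n k s : ℕ} (hs : s ≤ n) : Inks n k s = powEsymmIdeal n k s := by
  apply le_antisymm
  · refine Ideal.span_mono (Set.union_subset_union_right _ ?_)
    rintro _ ⟨d, h₁, -, rfl⟩
    exact ⟨d, by omega, rfl⟩
  · refine Ideal.span_le.2 ?_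
    rintro _ (⟨i, rfl⟩ | ⟨d, h, rfl⟩)
    · exact Ideal.subset_span (Or.inl ⟨i, rfl⟩)
    · rcases lt_or_ge n d with hd | hd
      · rw [esymm_eq_zero_of_lt hd]
        exact Ideal.zero_mem _
      · exact Ideal.subset_span (Or.inr ⟨d, by omega, hd, rfl⟩)

lemma powEsymmIdeal_le_succ (n k s : ℕ) : powEsymmIdeal n k s ≤ powEsymmIdeal n k (s + 1) := by
  refine Ideal.span_mono (Set.union_subset_union_right _ ?_)
  rintro _ ⟨d, h, rfl⟩
  exact ⟨d, by omega, rfl⟩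

lemma sum_esymm_mul_X_pow_eq_zero {n : ℕ} (i : Fin n) :
    ∑ j ∈ Finset.range (n + 1), (-1) ^ j * (esymm (Fin n) ℚ j * X i ^ (n - j)) = 0 := by
  have h := congrArg (Polynomial.eval (X i))
    (Multiset.prod_X_sub_X_eq_sum_esymm
      (Finset.univ.val.map (X : Fin n → MvPolynomial (Fin n) ℚ)))
  simp only [Multiset.map_map, Multiset.card_map, Finset.card_val, Finset.card_univ,
    Fintype.card_fin, ← esymm_eq_multiset_esymm, Polynomial.eval_finsetSum] at h
  rw [Polynomial.eval_multiset_prod, Multiset.prod_eq_zero] at h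
  · simpa using h.symm
  · simp only [Multiset.map_map, Multiset.mem_map]
    exact ⟨i, by simp, by simp⟩

lemma esymm_mul_X_pow_mem {n k s : ℕ} (hs : s ≤ k) (hn : s ≤ n) (i : Fin n) :
    esymm (Fin n) ℚ (n - s) * X i ^ k ∈ powEsymmIdeal n (k + 1) s := by
  have h := congrArg (X i ^ (k - s) * ·) (sum_esymm_mul_X_pow_eq_zero i)
  simp only [mul_zero, Finset.mul_sum] at h
  rw [← Finset.add_sum_erase _ _ (Finset.mem_range.2 (show n - s < n + 1 by omega))] at h
  have hmem : X i ^ (k - s) * ((-1) ^ (n - s) * (esymm (Fin n) ℚ (n - s) * X i ^ (n - (n - s))))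
      ∈ powEsymmIdeal n (k + 1) s := by
    rw [eq_neg_of_add_eq_zero_left h]
    refine neg_mem (Ideal.sum_mem _ fun j hj ↦ ?_)
    simp only [Finset.mem_erase, Finset.mem_range] at hj
    rcases lt_or_gt_of_ne hj.1 with hlt | hgt
    · have hX : X i ^ (k - s) * ((-1) ^ j * (esymm (Fin n) ℚ j * X i ^ (n - j)))
          = ((-1) ^ j * esymm (Fin n) ℚ j * X i ^ (n - s - j - 1)) * X i ^ (k + 1) := by
        have : (X i : MvPolynomial (Fin n) ℚ) ^ (k - s) * X i ^ (n - j)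
            = X i ^ (n - s - j - 1) * X i ^ (k + 1) := by
          rw [← pow_add, ← pow_add]
          congr 1
          omega
        linear_combination ((-1) ^ j * esymm (Fin n) ℚ j) * this
      rw [hX]
      exact Ideal.mul_mem_left _ _ (X_pow_mem_powEsymmIdeal i)
    · exact Ideal.mul_mem_left _ _ (Ideal.mul_mem_left _ _
        (Ideal.mul_mem_right _ _ (esymm_mem_powEsymmIdeal (by omega))))
  have hX : esymm (Fin n) ℚ (n - s) * X i ^ k = (-1) ^ (n - s) *
      (X i ^ (k - s) * ((-1) ^ (n - s) * (esymm (Fin n) ℚ (n - s) * X i ^ (n - (n - s))))) := by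
    have h₁ : (X i : MvPolynomial (Fin n) ℚ) ^ k = X i ^ (k - s) * X i ^ (n - (n - s)) := by
      rw [← pow_add]
      congr 1
      omega
    have h₂ : ((-1) ^ (n - s) * (-1) ^ (n - s) : MvPolynomial (Fin n) ℚ) = 1 := by
      rw [← mul_pow]
      simp
    rw [h₁]
    linear_combination (-(esymm (Fin n) ℚ (n - s) * X i ^ (k - s) * X i ^ (n - (n - s)))) * h₂
  rw [hX]
  exact Ideal.mul_mem_left _ _ hmem

lemma esymm_mul_mem {n k s : ℕ} (hs : s ≤ k) (hn : s ≤ n) {p : MvPolynomial (Fin n) ℚ}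
    (hp : p ∈ powEsymmIdeal n k s) :
    esymm (Fin n) ℚ (n - s) * p ∈ powEsymmIdeal n (k + 1) s := by
  induction hp using Submodule.span_induction with
  | mem x hx =>
    obtain ⟨i, rfl⟩ | ⟨d, h, rfl⟩ := hx
    · exact esymm_mul_X_pow_mem hs hn i
    · exact Ideal.mul_mem_left _ _ (esymm_mem_powEsymmIdeal h)
  | zero => simp
  | add x y _ _ hx hy => rw [mul_add]; exact add_mem hx hy
  | smul a x _ hx =>
    rw [smul_eq_mul, mul_left_comm]
    exact Ideal.mul_mem_left _ _ hx

lemma esymm_fin_succ (n d : ℕ) :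
    esymm (Fin (n + 1)) ℚ (d + 1) = rename Fin.succ (esymm (Fin n) ℚ (d + 1))
      + X 0 * rename Fin.succ (esymm (Fin n) ℚ d) := by
  have key (m : ℕ) : rename Fin.succ (esymm (Fin n) ℚ m)
      = (Finset.univ.val.map fun i : Fin n ↦ (X i.succ : MvPolynomial (Fin (n + 1)) ℚ)).esymm m := by
    rw [rename_eq_aeval, aeval_esymm_eq_multiset_esymm]
    rfl
  rw [key, key, esymm_eq_multiset_esymm, Fin.univ_succ, Finset.cons_val, Multiset.map_cons,
    Finset.map_val, Multiset.map_map]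
  simp only [Multiset.esymm, Multiset.powersetCard_cons, Multiset.map_add, Multiset.sum_add,
    Multiset.map_map]
  congr 1
  rw [← Multiset.sum_map_mul_left]
  simp

lemma X_pow_mul_rename_esymm_mem {n k s : ℕ} (j : ℕ) :
    ∀ d, n + 1 ≤ d + s → n + 1 ≤ d + j →
      X 0 ^ j * rename Fin.succ (esymm (Fin n) ℚ d) ∈ powEsymmIdeal (n + 1) k s := by
  induction j with
  | zero =>
    intro d _ h
    rw [esymm_eq_zero_of_lt (by omega)]
    simp
  | succ j ih =>
    intro d h₁ h₂
    have h : X 0 ^ (j + 1) * rename Fin.succ (esymm (Fin n) ℚ d)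
        = X 0 ^ j * esymm (Fin (n + 1)) ℚ (d + 1)
          - X 0 ^ j * rename Fin.succ (esymm (Fin n) ℚ (d + 1)) := by
      rw [esymm_fin_succ]
      ring
    rw [h]
    exact sub_mem (Ideal.mul_mem_left _ _ (esymm_mem_powEsymmIdeal (by omega)))
      (ih _ (by omega) (by omega))

lemma X_pow_mul_rename_mem {n k s t i : ℕ} (hts : s = t ∨ s = t + 1) (hti : s = t → s ≤ i)
    {p : MvPolynomial (Fin n) ℚ} (hp : p ∈ powEsymmIdeal n k t) :
    X 0 ^ i * rename Fin.succ p ∈ powEsymmIdeal (n + 1) k s ⊔ Ideal.span {X 0 ^ (i + 1)} := by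
  induction hp using Submodule.span_induction with
  | mem x hx =>
    obtain ⟨j, rfl⟩ | ⟨d, h, rfl⟩ := hx
    · rw [map_pow, rename_X]
      exact Ideal.mul_mem_left _ _ (Ideal.mem_sup_left (X_pow_mem_powEsymmIdeal _))
    · rcases hts with rfl | rfl
      · exact Ideal.mem_sup_left (X_pow_mul_rename_esymm_mem _ _ h (by have := hti rfl; omega))
      · rcases d with _ | d
        · have h0 := esymm_mem_powEsymmIdeal (n := n + 1) (k := k) (s := t + 1) (d := 0) (by omega)
          rw [esymm_zero] at h0 ⊢
          rw [map_one]
          exact Ideal.mul_mem_left _ _ (Ideal.mem_sup_left h0)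
        · have hd : X 0 ^ i * rename Fin.succ (esymm (Fin n) ℚ (d + 1))
              = X 0 ^ i * esymm (Fin (n + 1)) ℚ (d + 1)
                - rename Fin.succ (esymm (Fin n) ℚ d) * X 0 ^ (i + 1) := by
            rw [esymm_fin_succ]
            ring
          rw [hd]
          exact sub_mem
            (Ideal.mul_mem_left _ _ (Ideal.mem_sup_left (esymm_mem_powEsymmIdeal (by omega))))
            (Ideal.mul_mem_left _ _ (Ideal.mem_sup_right (Ideal.mem_span_singleton_self _)))
  | zero => simp
  | add x y _ _ hx hy => rw [map_add, mul_add]; exact add_mem hx hy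
  | smul a x _ hx =>
    rw [smul_eq_mul, map_mul, mul_left_comm]
    exact Ideal.mul_mem_left _ _ hx

lemma exists_eq_rename_add_X_mul {n : ℕ} (p : MvPolynomial (Fin (n + 1)) ℚ) :
    ∃ q r, p = rename Fin.succ q + X 0 * r := by
  induction p using MvPolynomial.induction_on with
  | C a => exact ⟨C a, 0, by simp⟩
  | add p₁ p₂ h₁ h₂ =>
    obtain ⟨q₁, r₁, rfl⟩ := h₁
    obtain ⟨q₂, r₂, rfl⟩ := h₂
    exact ⟨q₁ + q₂, r₁ + r₂, by rw [map_add]; ring⟩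
  | mul_X p i h =>
    obtain ⟨q, r, rfl⟩ := h
    refine Fin.cases ⟨0, rename Fin.succ q + X 0 * r, by simp [mul_comm]⟩ (fun j ↦ ?_) i
    exact ⟨q * X j, r * X j.succ, by rw [map_mul, rename_X]; ring⟩

/-- The number of words of length `n` in `k` letters using each of `s` distinguished letters,
defined through iterated differences of `k ↦ k ^ n`. -/
def wordCount (n : ℕ) (k : ℤ) : ℕ → ℤ
  | 0 => k ^ n
  | s + 1 => wordCount n k s - wordCount n (k - 1) s

lemma wordCount_zero_succ (k : ℤ) (s : ℕ) : wordCount 0 k (s + 1) = 0 := by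
  induction s generalizing k with
  | zero => simp [wordCount]
  | succ s ih => rw [wordCount, ih, ih, sub_zero]

lemma wordCount_succ_zero (n : ℕ) (k : ℤ) : wordCount (n + 1) k 0 = k * wordCount n k 0 := by
  simp only [wordCount]
  ring

lemma wordCount_succ_succ (n : ℕ) (k : ℤ) (s : ℕ) :
    wordCount (n + 1) k (s + 1)
      = (s + 1) * wordCount n k s + (k - (s + 1)) * wordCount n k (s + 1) := by
  induction s generalizing k with
  | zero =>
    simp only [wordCount]
    push_cast
    ring
  | succ s ih =>
    rw [wordCount, ih, ih]
    simp only [wordCount]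
    push_cast
    ring

/-- Every polynomial is congruent modulo `I` to a rational combination of elements of `S`. -/
def SpansModulo {n : ℕ} (S : Finset (MvPolynomial (Fin n) ℚ))
    (I : Ideal (MvPolynomial (Fin n) ℚ)) : Prop :=
  ∀ p, ∃ w ∈ Submodule.span ℚ (S : Set (MvPolynomial (Fin n) ℚ)), p - w ∈ I

lemma spansModulo_biUnion {n k s : ℕ} (t : ℕ → ℕ)
    (ht : ∀ i < k, (s = t i ∨ s = t i + 1) ∧ (s = t i → s ≤ i))
    (S : ℕ → Finset (MvPolynomial (Fin n) ℚ))
    (hS : ∀ i < k, SpansModulo (S i) (powEsymmIdeal n k (t i))) :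
    SpansModulo ((Finset.range k).biUnion fun i ↦
      (S i).image fun q ↦ X 0 ^ i * rename Fin.succ q) (powEsymmIdeal (n + 1) k s) := by
  classical
  set T := (Finset.range k).biUnion fun i ↦
    (S i).image fun q ↦ X 0 ^ i * rename Fin.succ q with hT
  have key : ∀ j ≤ k, ∀ p : MvPolynomial (Fin (n + 1)) ℚ,
      ∃ w ∈ Submodule.span ℚ (T : Set (MvPolynomial (Fin (n + 1)) ℚ)),
        X 0 ^ (k - j) * p - w ∈ powEsymmIdeal (n + 1) k s := by
    intro j
    induction j with
    | zero =>
      intro _ p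
      refine ⟨0, zero_mem _, ?_⟩
      rw [sub_zero, Nat.sub_zero]
      exact Ideal.mul_mem_right _ _ (X_pow_mem_powEsymmIdeal _)
    | succ j ih =>
      intro hj p
      obtain ⟨i, hi⟩ : ∃ i, k - (j + 1) = i := ⟨_, rfl⟩
      have hik : i < k := by omega
      rw [hi]
      obtain ⟨q, r, rfl⟩ := exists_eq_rename_add_X_mul p
      obtain ⟨w, hw, hqw⟩ := hS i hik q
      obtain ⟨a, ha, b, hb, hab⟩ := Submodule.mem_sup.1
        (X_pow_mul_rename_mem (ht i hik).1 (ht i hik).2 hqw)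
      obtain ⟨c, rfl⟩ := Ideal.mem_span_singleton'.1 hb
      obtain ⟨v, hv, hcv⟩ := ih (by omega) (c + r)
      rw [show k - j = i + 1 by omega] at hcv
      refine ⟨X 0 ^ i * rename Fin.succ w + v, add_mem ?_ hv, ?_⟩
      · have hmap := Submodule.mem_map_of_mem
          (f := (LinearMap.mulLeft ℚ (X 0 ^ i : MvPolynomial (Fin (n + 1)) ℚ)).comp
            (rename Fin.succ : MvPolynomial (Fin n) ℚ →ₐ[ℚ] _).toLinearMap) hw
        rw [Submodule.map_span] at hmap
        refine Submodule.span_mono ?_ hmap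
        rintro _ ⟨u, hu, rfl⟩
        rw [hT]
        simp only [Finset.coe_biUnion, Set.mem_iUnion]
        exact ⟨i, by simpa using hik, Finset.mem_coe.2 (Finset.mem_image_of_mem _ hu)⟩
      · have h : X 0 ^ i * (rename Fin.succ q + X 0 * r) - (X 0 ^ i * rename Fin.succ w + v)
            = a + (X 0 ^ (i + 1) * (c + r) - v) := by
          rw [map_sub] at hab
          linear_combination -hab
        rw [h]
        exact add_mem ha hcv
  intro p
  simpa using key k le_rfl p

lemma exists_spansModulo (n : ℕ) : ∀ k s : ℕ, s ≤ k →
    ∃ S : Finset (MvPolynomial (Fin n) ℚ),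
      SpansModulo S (powEsymmIdeal n k s) ∧ (S.card : ℤ) ≤ wordCount n k s := by
  classical
  induction n with
  | zero =>
    intro k s _
    rcases s with _ | s
    · refine ⟨{1}, fun p ↦ ⟨p, ?_, by simp⟩, by simp [wordCount]⟩
      obtain ⟨a, rfl⟩ := C_surjective (R := ℚ) (Fin 0) p
      rw [Finset.coe_singleton, Submodule.mem_span_singleton]
      exact ⟨a, by rw [smul_eq_C_mul, mul_one]⟩
    · refine ⟨∅, fun p ↦ ⟨0, zero_mem _, ?_⟩, by simp [wordCount_zero_succ]⟩
      have h := esymm_mem_powEsymmIdeal (n := 0) (k := k) (s := s + 1) (d := 0) (by omega)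
      rw [esymm_zero] at h
      simpa using Ideal.mul_mem_left _ (p - 0) h
  | succ n ih =>
    intro k s hs
    rcases s with _ | s
    · obtain ⟨S, hS, hcard⟩ := ih k 0 hs
      refine ⟨_, spansModulo_biUnion (fun _ ↦ 0) (by simp) (fun _ ↦ S) (fun _ _ ↦ hS), ?_⟩
      rw [wordCount_succ_zero]
      refine le_trans (Nat.cast_le.2 (Finset.card_biUnion_le_card_mul _ _ S.card
        fun _ _ ↦ Finset.card_image_le)) ?_
      rw [Finset.card_range]
      push_cast
      exact mul_le_mul_of_nonneg_left hcard (by positivity)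
    · obtain ⟨S, hS, hcardS⟩ := ih k s (by omega)
      obtain ⟨S', hS', hcardS'⟩ := ih k (s + 1) hs
      refine ⟨_, spansModulo_biUnion (fun i ↦ if i < s + 1 then s else s + 1) ?_
        (fun i ↦ if i < s + 1 then S else S') ?_, ?_⟩
      · intro i _
        split_ifs <;> omega
      · intro i _
        split_ifs
        · exact hS
        · exact hS'
      · refine le_trans (Nat.cast_le.2 (Finset.card_biUnion_le.trans
          (Finset.sum_le_sum fun _ _ ↦ Finset.card_image_le))) ?_
        obtain ⟨m, rfl⟩ := Nat.exists_eq_add_of_le hs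
        rw [wordCount_succ_succ, Finset.sum_range_add,
          Finset.sum_congr rfl (g := fun _ ↦ S.card)
            (fun i hi ↦ by rw [if_pos (Finset.mem_range.1 hi)])]
        simp only [Nat.not_lt.2 (Nat.le_add_right _ _), if_false, Finset.sum_const,
          Finset.card_range, smul_eq_mul]
        push_cast at hcardS hcardS' ⊢
        rw [add_sub_cancel_left]
        gcongr

lemma finite_and_finrank_le_of_spansModulo {n : ℕ} {S : Finset (MvPolynomial (Fin n) ℚ)}
    {I : Ideal (MvPolynomial (Fin n) ℚ)} (h : SpansModulo S I) :
    Module.Finite ℚ (MvPolynomial (Fin n) ℚ ⧸ I) ∧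
      Module.finrank ℚ (MvPolynomial (Fin n) ℚ ⧸ I) ≤ S.card := by
  classical
  have htop : Submodule.span ℚ ((S.image (Ideal.Quotient.mkₐ ℚ I) : Finset _) :
      Set (MvPolynomial (Fin n) ℚ ⧸ I)) = ⊤ := by
    refine eq_top_iff.2 fun x _ ↦ ?_
    obtain ⟨p, rfl⟩ := Ideal.Quotient.mkₐ_surjective ℚ I x
    obtain ⟨w, hw, hpw⟩ := h p
    have hmap := Submodule.mem_map_of_mem (f := (Ideal.Quotient.mkₐ ℚ I).toLinearMap) hw
    rw [Submodule.map_span] at hmap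
    have hpw' : Ideal.Quotient.mkₐ ℚ I p = Ideal.Quotient.mkₐ ℚ I w := Ideal.Quotient.eq.2 hpw
    rw [Finset.coe_image, hpw']
    exact hmap
  refine ⟨⟨⟨_, htop⟩⟩, ?_⟩
  rw [← finrank_top, ← htop]
  exact (finrank_span_finset_le_card _).trans Finset.card_image_le

lemma finite_quotient_powEsymmIdeal {n k s : ℕ} (hs : s ≤ k) :
    Module.Finite ℚ (MvPolynomial (Fin n) ℚ ⧸ powEsymmIdeal n k s) :=
  have ⟨_, hS, _⟩ := exists_spansModulo n k s hs
  (finite_and_finrank_le_of_spansModulo hS).1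

lemma finrank_quotient_powEsymmIdeal_le {n k s : ℕ} (hs : s ≤ k) :
    (Module.finrank ℚ (MvPolynomial (Fin n) ℚ ⧸ powEsymmIdeal n k s) : ℤ) ≤ wordCount n k s :=
  have ⟨_, hS, hcard⟩ := exists_spansModulo n k s hs
  (Nat.cast_le.2 (finite_and_finrank_le_of_spansModulo hS).2).trans hcard

lemma coeff_eq_zero_of_mem_powEsymmIdeal_zero {n k : ℕ} {p : MvPolynomial (Fin n) ℚ}
    (hp : p ∈ powEsymmIdeal n k 0) {m : Fin n →₀ ℕ} (hm : ∀ i, m i < k) : coeff m p = 0 := by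
  classical
  have hle : powEsymmIdeal n k 0 ≤ Ideal.span ((fun m ↦ monomial m (1 : ℚ)) ''
      Set.range fun i : Fin n ↦ Finsupp.single i k) := by
    refine Ideal.span_le.2 ?_
    rintro _ (⟨i, rfl⟩ | ⟨d, h, rfl⟩)
    · exact Ideal.subset_span ⟨_, ⟨i, rfl⟩, (X_pow_eq_monomial).symm⟩
    · rw [esymm_eq_zero_of_lt (by omega)]
      exact Ideal.zero_mem _
  by_contra h
  obtain ⟨_, ⟨i, rfl⟩, hi⟩ := mem_ideal_span_monomial_image.1 (hle hp) m (mem_support_iff.2 h)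
  have := hi i
  rw [Finsupp.single_eq_same] at this
  exact absurd (hm i) (by omega)

lemma pow_le_finrank_quotient_powEsymmIdeal_zero (n k : ℕ) :
    k ^ n ≤ Module.finrank ℚ (MvPolynomial (Fin n) ℚ ⧸ powEsymmIdeal n k 0) := by
  classical
  have := finite_quotient_powEsymmIdeal (n := n) (k := k) (Nat.zero_le k)
  let e (f : Fin n → Fin k) : Fin n →₀ ℕ := Finsupp.equivFunOnFinite.symm fun i ↦ (f i : ℕ)
  have he : Function.Injective e := fun f g h ↦ funext fun i ↦
    Fin.ext (congrFun (Finsupp.equivFunOnFinite.symm.injective h) i)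
  have hli : LinearIndependent ℚ fun f ↦
      Ideal.Quotient.mkₐ ℚ (powEsymmIdeal n k 0) (monomial (e f) 1) := by
    rw [Fintype.linearIndependent_iff]
    intro g hg f
    simp only [← map_smul, ← map_sum] at hg
    have hc := coeff_eq_zero_of_mem_powEsymmIdeal_zero (Ideal.Quotient.eq_zero_iff_mem.1 hg)
      (m := e f) (fun i ↦ (f i).2)
    simpa [coeff_sum, coeff_monomial, he.eq_iff] using hc
  simpa using hli.fintype_card_le_finrank

/-- Multiplication by `e_{n-s}`, as a map of quotients. -/
noncomputable def mulEsymm {n k s : ℕ} (hs : s ≤ k) (hn : s ≤ n) :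
    (MvPolynomial (Fin n) ℚ ⧸ powEsymmIdeal n k s) →ₗ[ℚ]
      (MvPolynomial (Fin n) ℚ ⧸ powEsymmIdeal n (k + 1) s) :=
  (Submodule.mapQ (powEsymmIdeal n k s) (powEsymmIdeal n (k + 1) s)
    (LinearMap.mulLeft (MvPolynomial (Fin n) ℚ) (esymm (Fin n) ℚ (n - s)))
    (fun _ hp ↦ esymm_mul_mem hs hn hp)).restrictScalars ℚ

/-- The canonical projection between consecutive quotients. -/
noncomputable def projSucc (n k s : ℕ) :
    (MvPolynomial (Fin n) ℚ ⧸ powEsymmIdeal n k s) →ₗ[ℚ]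
      (MvPolynomial (Fin n) ℚ ⧸ powEsymmIdeal n k (s + 1)) :=
  (Ideal.Quotient.factorₐ ℚ (powEsymmIdeal_le_succ n k s)).toLinearMap

lemma mulEsymm_mk {n k s : ℕ} (hs : s ≤ k) (hn : s ≤ n) (p : MvPolynomial (Fin n) ℚ) :
    mulEsymm hs hn (Ideal.Quotient.mk _ p)
      = Ideal.Quotient.mk (powEsymmIdeal n (k + 1) s) (esymm (Fin n) ℚ (n - s) * p) :=
  rfl

lemma projSucc_mk {n k s : ℕ} (p : MvPolynomial (Fin n) ℚ) :
    projSucc n k s (Ideal.Quotient.mk _ p) = Ideal.Quotient.mk (powEsymmIdeal n k (s + 1)) p :=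
  rfl

lemma projSucc_surjective (n k s : ℕ) : Function.Surjective (projSucc n k s) :=
  Ideal.Quotient.factor_surjective (powEsymmIdeal_le_succ n k s)

lemma powEsymmIdeal_succ_le {n k s : ℕ} (hn : s ≤ n) :
    powEsymmIdeal n k (s + 1) ≤ powEsymmIdeal n k s ⊔ Ideal.span {esymm (Fin n) ℚ (n - s)} := by
  refine Ideal.span_le.2 ?_
  rintro _ (⟨i, rfl⟩ | ⟨d, h, rfl⟩)
  · exact Ideal.mem_sup_left (X_pow_mem_powEsymmIdeal i)
  · rcases Nat.lt_or_ge n (d + s) with hd | hd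
    · exact Ideal.mem_sup_left (esymm_mem_powEsymmIdeal hd)
    · obtain rfl : d = n - s := by omega
      exact Ideal.mem_sup_right (Ideal.mem_span_singleton_self _)

lemma range_mulEsymm {n k s : ℕ} (hs : s ≤ k) (hn : s ≤ n) :
    LinearMap.range (mulEsymm hs hn) = LinearMap.ker (projSucc n (k + 1) s) := by
  apply le_antisymm
  · rintro _ ⟨x, rfl⟩
    obtain ⟨p, rfl⟩ := Ideal.Quotient.mk_surjective x
    rw [LinearMap.mem_ker, mulEsymm_mk, projSucc_mk, Ideal.Quotient.eq_zero_iff_mem]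
    exact Ideal.mul_mem_right _ _ (esymm_mem_powEsymmIdeal (by omega))
  · intro x hx
    obtain ⟨p, rfl⟩ := Ideal.Quotient.mk_surjective x
    rw [LinearMap.mem_ker, projSucc_mk, Ideal.Quotient.eq_zero_iff_mem] at hx
    obtain ⟨a, ha, b, hb, rfl⟩ := Submodule.mem_sup.1 (powEsymmIdeal_succ_le hn hx)
    obtain ⟨c, rfl⟩ := Ideal.mem_span_singleton'.1 hb
    refine ⟨Ideal.Quotient.mk _ c, ?_⟩
    rw [mulEsymm_mk, map_add, Ideal.Quotient.eq_zero_iff_mem.2 ha, zero_add, mul_comm]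

lemma finrank_range_mulEsymm_add {n k s : ℕ} (hs : s ≤ k) (hn : s ≤ n) :
    Module.finrank ℚ (LinearMap.range (mulEsymm hs hn))
        + Module.finrank ℚ (MvPolynomial (Fin n) ℚ ⧸ powEsymmIdeal n (k + 1) (s + 1))
      = Module.finrank ℚ (MvPolynomial (Fin n) ℚ ⧸ powEsymmIdeal n (k + 1) s) := by
  have := finite_quotient_powEsymmIdeal (n := n) (show s ≤ k + 1 by omega)
  rw [range_mulEsymm, ← LinearMap.finrank_range_add_finrank_ker (projSucc n (k + 1) s), add_comm,
    LinearMap.range_eq_top.2 (projSucc_surjective n (k + 1) s), finrank_top]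

lemma finrank_quotient_powEsymmIdeal {n s : ℕ} (hn : s ≤ n) : ∀ {k : ℕ}, s ≤ k →
    (Module.finrank ℚ (MvPolynomial (Fin n) ℚ ⧸ powEsymmIdeal n k s) : ℤ) = wordCount n k s := by
  induction s with
  | zero =>
    intro k hk
    refine le_antisymm (finrank_quotient_powEsymmIdeal_le hk) ?_
    rw [wordCount]
    exact_mod_cast pow_le_finrank_quotient_powEsymmIdeal_zero n k
  | succ s ih =>
    intro k hk
    obtain ⟨k, rfl⟩ : ∃ m, k = m + 1 := ⟨k - 1, by omega⟩
    refine le_antisymm (finrank_quotient_powEsymmIdeal_le hk) ?_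
    have hsk : s ≤ k := by omega
    have := finite_quotient_powEsymmIdeal (n := n) hsk
    have h₁ := finrank_range_mulEsymm_add hsk (show s ≤ n by omega)
    have h₂ := LinearMap.finrank_range_le (mulEsymm hsk (show s ≤ n by omega))
    have h₃ := ih (by omega) (show s ≤ k + 1 by omega)
    have h₄ := ih (by omega) hsk
    rw [wordCount, show ((k + 1 : ℕ) : ℤ) - 1 = k by push_cast; ring]
    omega

lemma mulEsymm_injective {n k s : ℕ} (hs : s ≤ k) (hn : s + 1 ≤ n) :
    Function.Injective (mulEsymm hs (Nat.le_of_succ_le hn)) := by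
  have := finite_quotient_powEsymmIdeal (n := n) hs
  have h₁ := finrank_range_mulEsymm_add hs (Nat.le_of_succ_le hn)
  have h₂ := LinearMap.finrank_range_add_finrank_ker (mulEsymm hs (Nat.le_of_succ_le hn))
  have h₃ := finrank_quotient_powEsymmIdeal (n := n) (s := s) (by omega) hs
  have h₄ := finrank_quotient_powEsymmIdeal (n := n) (s := s) (by omega) (show s ≤ k + 1 by omega)
  have h₅ := finrank_quotient_powEsymmIdeal (k := k + 1) hn (by omega)
  rw [wordCount, show ((k + 1 : ℕ) : ℤ) - 1 = k by push_cast; ring] at h₅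
  rw [← LinearMap.ker_eq_bot, ← Submodule.finrank_eq_zero (R := ℚ)]
  omega

/-- For `s < k ≤ n`: multiplication by `e_{n−s}` maps `I_{n,k−1,s}` into `I_{n,k,s}` and
`I_{n,k,s} ⊆ I_{n,k,s+1}`, and so there are an induced `ℚ`-linear map
`φ : R_{n,k−1,s} → R_{n,k,s}` (given by multiplication by `e_{n−s}(x_1, …, x_n)`, hence
homogeneous of degree `n−s`) and the canonical projection `π : R_{n,k,s} → R_{n,k,s+1}`,
which form a short exact sequence `0 → R_{n,k−1,s} → R_{n,k,s} → R_{n,k,s+1} → 0`: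
`φ` is injective, `π` is surjective, and `range φ = ker π`. -/
theorem stmt18 (n k s : ℕ) (hs : 1 ≤ s) (hsk : s < k) (hkn : k ≤ n) :
    (∀ p ∈ Inks n (k - 1) s, esymm (Fin n) ℚ (n - s) * p ∈ Inks n k s) ∧
    Inks n k s ≤ Inks n k (s + 1) ∧
    ∃ (φ : (MvPolynomial (Fin n) ℚ ⧸ Inks n (k - 1) s) →ₗ[ℚ]
            (MvPolynomial (Fin n) ℚ ⧸ Inks n k s))
      (pr : (MvPolynomial (Fin n) ℚ ⧸ Inks n k s) →ₗ[ℚ]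
            (MvPolynomial (Fin n) ℚ ⧸ Inks n k (s + 1))),
      (∀ p : MvPolynomial (Fin n) ℚ,
        φ (Ideal.Quotient.mk (Inks n (k - 1) s) p)
          = Ideal.Quotient.mk (Inks n k s) (esymm (Fin n) ℚ (n - s) * p)) ∧
      (∀ p : MvPolynomial (Fin n) ℚ,
        pr (Ideal.Quotient.mk (Inks n k s) p)
          = Ideal.Quotient.mk (Inks n k (s + 1)) p) ∧
      Function.Injective φ ∧ Function.Surjective pr ∧
      LinearMap.range φ = LinearMap.ker pr := by
  obtain ⟨k, rfl⟩ : ∃ m, k = m + 1 := ⟨k - 1, by omega⟩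
  have hk : s ≤ k := by omega
  have hn : s + 1 ≤ n := by omega
  rw [Nat.add_sub_cancel, Inks_eq_powEsymmIdeal (Nat.le_of_succ_le hn),
    Inks_eq_powEsymmIdeal (Nat.le_of_succ_le hn), Inks_eq_powEsymmIdeal hn]
  exact ⟨fun _ ↦ esymm_mul_mem hk (Nat.le_of_succ_le hn), powEsymmIdeal_le_succ n (k + 1) s,
    mulEsymm hk (Nat.le_of_succ_le hn), projSucc n (k + 1) s, mulEsymm_mk hk _, projSucc_mk,
    mulEsymm_injective hk hn, projSucc_surjective n (k + 1) s, range_mulEsymm hk _⟩
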